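/- Fix a set R ⊆ F∖{0} of representatives for the cosets of the subgroup of nonzero squares (F*)² in F* (i.e., for every b ∈ F* there is exactly one q ∈ R such that b/q is a square). Let E ⊆ W(2) be the set consisting of all elements w₁(c) = e₈ + e₂ − e₁ + c(3e₈ + e₅ − 2e₁) (c ∈ F), w₂(c,d) = −e₁ + c(e₅ − 2e₁) + d·e₈ (c,d ∈ F), w₃(c,d) = −e₁ − 2e₈ + 4e₃ + e₆ + 3e₇ + c(3e₈ − e₅ + 2e₁) + d·e₄ (c,d ∈ F), and w₄(c,q) = −e₁ − 2e₈ + c(3e₈ − e₅ + 2e₁) + q·e₄ (c ∈ F, q ∈ R). Then for every w ∈ E and every algebra automorphism g of W(2), if g(w) ∈ E then g(w) = w; consequently distinct elements of E lie in distinct Aut(W(2))-orbits. -/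

import Mathlib

noncomputable section

variable (F : Type*) [Field F] [CharZero F]

abbrev V2 (F : Type*) [Field F] : Type _ := Fin 2 → F

abbrev WW (F : Type*) [Field F] : Type _ := V2 F →ₗ[F] V2 F →ₗ[F] V2 F

def vone : V2 F := ![1, 0]

/-- The multiplication on the space of bilinear maps. -/
def wmul (A B : WW F) : WW F :=
  LinearMap.mk₂ F
    (fun x y => A (vone F) (B x y) - B (A (vone F) x) y - B x (A (vone F) y))
    (fun x x' y => by simp only [map_add, LinearMap.add_apply]; abel)
    (fun c x y => by simp only [map_smul, LinearMap.smul_apply, smul_sub])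
    (fun x y y' => by simp only [map_add, LinearMap.add_apply]; abel)
    (fun c x y => by simp only [map_smul, LinearMap.smul_apply, smul_sub])

/-- α_{ij}^k -/
def alphaM (i j k : Fin 2) : WW F :=
  LinearMap.mk₂ F (fun x y => (x i * y j) • (Pi.single k (1 : F) : V2 F))
    (fun x x' y => by simp [add_mul, add_smul])
    (fun c x y => by simp [smul_smul, mul_assoc])
    (fun x y y' => by simp [mul_add, add_smul])
    (fun c x y => by simp [smul_smul, mul_assoc, mul_left_comm])

/-- The basis e₁, …, e₈ of W(2) (indexed 0,…,7). -/
def bE : Fin 8 → WW F :=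
  ![alphaM F 0 0 0 - alphaM F 0 1 1 - alphaM F 1 0 1,
    alphaM F 0 0 1,
    alphaM F 1 1 1 - alphaM F 0 1 0 - alphaM F 1 0 0,
    alphaM F 1 1 0,
    (2 : F) • alphaM F 0 0 0 + alphaM F 0 1 1 + alphaM F 1 0 1,
    (2 : F) • alphaM F 1 1 1 + alphaM F 0 1 0 + alphaM F 1 0 0,
    alphaM F 0 1 0 - alphaM F 1 0 0,
    alphaM F 0 1 1 - alphaM F 1 0 1]


def w1 (c : F) : WW F :=
  bE F 7 + bE F 1 - bE F 0 + c • ((3 : F) • bE F 7 + bE F 4 - (2 : F) • bE F 0)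

def w2 (c d : F) : WW F :=
  -bE F 0 + c • (bE F 4 - (2 : F) • bE F 0) + d • bE F 7

def w3 (c d : F) : WW F :=
  -bE F 0 - (2 : F) • bE F 7 + (4 : F) • bE F 2 + bE F 5 + (3 : F) • bE F 6
    + c • ((3 : F) • bE F 7 - bE F 4 + (2 : F) • bE F 0) + d • bE F 3

def w4 (c q : F) : WW F :=
  -bE F 0 - (2 : F) • bE F 7 + c • ((3 : F) • bE F 7 - bE F 4 + (2 : F) • bE F 0)
    + q • bE F 3

/-- g is an algebra automorphism of W(2). -/
def IsAut (g : WW F ≃ₗ[F] WW F) : Prop :=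
  ∀ A B : WW F, g (wmul F A B) = wmul F (g A) (g B)

/-- y lies in the Aut(W(2))-orbit of x. -/
def InOrbit (x y : WW F) : Prop :=
  ∃ g : WW F ≃ₗ[F] WW F, IsAut F g ∧ g x = y

/-- The set E of representatives of idempotents. -/
def ESet (R : Set F) : Set (WW F) :=
  {w | (∃ c : F, w = w1 F c) ∨ (∃ c d : F, w = w2 F c d) ∨
    (∃ c d : F, w = w3 F c d) ∨ ∃ c q : F, q ∈ R ∧ w = w4 F c q}

section

variable {K : Type*} [Field K]

/-- The action of an endomorphism `a` of `V₂` on bilinear maps by derivations. -/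
def derAct (a : V2 K →ₗ[K] V2 K) (B : WW K) : WW K :=
  LinearMap.mk₂ K (fun x y => a (B x y) - B (a x) y - B x (a y))
    (fun x x' y => by simp only [map_add, LinearMap.add_apply]; abel)
    (fun c x y => by simp only [map_smul, LinearMap.smul_apply, smul_sub])
    (fun x y y' => by simp only [map_add]; abel)
    (fun c x y => by simp only [map_smul, smul_sub])

theorem derAct_apply (a : V2 K →ₗ[K] V2 K) (B : WW K) (x y : V2 K) :
    derAct a B x y = a (B x y) - B (a x) y - B x (a y) := rfl

theorem derAct_apply_eq_lie_sub (a : V2 K →ₗ[K] V2 K) (B : WW K) (x : V2 K) :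
    derAct a B x = (a * B x - B x * a) - B (a x) := by
  refine LinearMap.ext fun y => ?_
  simp only [derAct_apply, LinearMap.sub_apply, Module.End.mul_apply]
  abel

theorem wmul_eq_derAct (A B : WW K) : wmul K A B = derAct (A (vone K)) B := rfl

theorem derAct_sub (a b : V2 K →ₗ[K] V2 K) (B : WW K) :
    derAct (a - b) B = derAct a B - derAct b B := by
  refine LinearMap.ext₂ fun x y => ?_
  simp only [derAct_apply, LinearMap.sub_apply, map_sub]
  abel

theorem derAct_lie (a b : V2 K →ₗ[K] V2 K) (B : WW K) :
    derAct (a * b - b * a) B = derAct a (derAct b B) - derAct b (derAct a B) := by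
  refine LinearMap.ext₂ fun x y => ?_
  simp only [derAct_apply, LinearMap.sub_apply, map_sub, Module.End.mul_apply]
  abel

/-- The linear map sending `a` to the map `x ↦ x₁ • a`; it is a section of evaluation at `v₁`. -/
def firstCoordSMul (M : Type*) [AddCommGroup M] [Module K M] : M →ₗ[K] V2 K →ₗ[K] M :=
  LinearMap.smulRightₗ (LinearMap.proj (φ := fun _ : Fin 2 => K) 0)

theorem firstCoordSMul_vone {M : Type*} [AddCommGroup M] [Module K M] (a : M) :
    firstCoordSMul M a (vone K) = a := by
  simp [firstCoordSMul, vone]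

theorem eq_zero_of_forall_apply_eq_zero {x : V2 K} (h : ∀ A : WW K, A x = 0) : x = 0 := by
  ext i
  have h1 := LinearMap.congr_fun (h ((LinearMap.proj (R := K) (φ := fun _ : Fin 2 => K) i).smulRight
    LinearMap.id)) (Pi.single i 1)
  simpa using congr_fun h1 i

theorem eq_of_forall_apply_eq {x y : V2 K} (h : ∀ A : WW K, A x = A y) : x = y :=
  sub_eq_zero.1 <| eq_zero_of_forall_apply_eq_zero fun A => by rw [map_sub, h, sub_self]

/-- The action of `End V₂` on bilinear maps is faithful. -/
theorem eq_of_forall_derAct_eq {a b : V2 K →ₗ[K] V2 K} (h : ∀ B, derAct a B = derAct b B) :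
    a = b := by
  rw [← sub_eq_zero]
  set c := a - b with hc
  have scalar (u : V2 K) : c u = (2 * c (vone K) 0) • u := by
    have h0 : derAct c (firstCoordSMul _ (firstCoordSMul _ u)) = 0 := by
      rw [hc, derAct_sub]
      exact sub_eq_zero.2 (h _)
    have h1 := LinearMap.congr_fun₂ h0 (vone K) (vone K)
    rw [derAct_apply, firstCoordSMul_vone, firstCoordSMul_vone] at h1
    simp only [firstCoordSMul, LinearMap.smulRightₗ_apply, LinearMap.smulRight_apply,
      LinearMap.smul_apply, LinearMap.proj_apply, LinearMap.zero_apply] at h1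
    have h2 : vone K 0 = 1 := rfl
    rw [h2, one_smul, sub_sub, sub_eq_zero] at h1
    rw [h1, two_mul, add_smul]
  have hz : c (vone K) 0 = 0 := by
    have := congr_fun (scalar (vone K)) 0
    have h2 : vone K 0 = 1 := rfl
    rw [Pi.smul_apply, smul_eq_mul, h2, mul_one] at this
    linear_combination -this
  refine LinearMap.ext fun u => ?_
  rw [scalar, hz, mul_zero, zero_smul, LinearMap.zero_apply]

/-- The map induced on `End V₂` by a linear automorphism `g` of the space of bilinear maps. -/
def inducedEnd (g : WW K ≃ₗ[K] WW K) : (V2 K →ₗ[K] V2 K) →ₗ[K] V2 K →ₗ[K] V2 K :=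
  LinearMap.applyₗ (vone K) ∘ₗ g.toLinearMap ∘ₗ firstCoordSMul _

theorem inducedEnd_apply (g : WW K ≃ₗ[K] WW K) (a : V2 K →ₗ[K] V2 K) :
    inducedEnd g a = g (firstCoordSMul _ a) (vone K) := rfl

theorem IsAut.map_derAct {g : WW K ≃ₗ[K] WW K} (hg : IsAut K g) (a : V2 K →ₗ[K] V2 K)
    (B : WW K) : g (derAct a B) = derAct (inducedEnd g a) (g B) := by
  have h := hg (firstCoordSMul _ a) B
  rwa [wmul_eq_derAct, wmul_eq_derAct, firstCoordSMul_vone, ← inducedEnd_apply] at h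

theorem IsAut.apply_vone {g : WW K ≃ₗ[K] WW K} (hg : IsAut K g) (A : WW K) :
    g A (vone K) = inducedEnd g (A (vone K)) := by
  refine eq_of_forall_derAct_eq fun B => ?_
  obtain ⟨B, rfl⟩ := g.surjective B
  rw [← hg.map_derAct, ← wmul_eq_derAct, ← wmul_eq_derAct, hg]

theorem IsAut.inducedEnd_lie {g : WW K ≃ₗ[K] WW K} (hg : IsAut K g) (a b : V2 K →ₗ[K] V2 K) :
    inducedEnd g (a * b - b * a) =
      inducedEnd g a * inducedEnd g b - inducedEnd g b * inducedEnd g a := by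
  refine eq_of_forall_derAct_eq fun B => ?_
  obtain ⟨B, rfl⟩ := g.surjective B
  rw [← hg.map_derAct]
  simp only [derAct_lie, ← hg.map_derAct]
  exact map_sub g _ _

theorem IsAut.inducedEnd_injective {g : WW K ≃ₗ[K] WW K} (hg : IsAut K g) :
    Function.Injective (inducedEnd g) := fun a b hab =>
  eq_of_forall_derAct_eq fun B => g.injective <| by rw [hg.map_derAct, hg.map_derAct, hab]

theorem IsAut.apply_inducedEnd {g : WW K ≃ₗ[K] WW K} (hg : IsAut K g) {p x : V2 K}
    (h : ∀ A, g A p = inducedEnd g (A x)) (a : V2 K →ₗ[K] V2 K) (A : WW K) :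
    g A (inducedEnd g a p) = inducedEnd g (A (a x)) := by
  have h1 := h (derAct a A)
  rw [hg.map_derAct, derAct_apply_eq_lie_sub, derAct_apply_eq_lie_sub, map_sub,
    hg.inducedEnd_lie, h] at h1
  exact sub_right_injective h1

/-- Every automorphism of `W(2)` is the natural action of a linear automorphism of `V₂`
fixing `v₁`. -/
theorem IsAut.exists_linearMap {g : WW K ≃ₗ[K] WW K} (hg : IsAut K g) :
    ∃ P : V2 K →ₗ[K] V2 K, Function.Injective P ∧ P (vone K) = vone K ∧
      ∀ A x y, g A (P x) (P y) = P (A x y) := by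
  let P : V2 K →ₗ[K] V2 K :=
    LinearMap.applyₗ (vone K) ∘ₗ inducedEnd g ∘ₗ firstCoordSMul (V2 K)
  have hP (x : V2 K) (A : WW K) : g A (P x) = inducedEnd g (A x) := by
    have := hg.apply_inducedEnd hg.apply_vone (firstCoordSMul (V2 K) x) A
    rwa [firstCoordSMul_vone] at this
  refine ⟨P, ?_, ?_, fun A x y => ?_⟩
  · refine fun x y hxy => eq_of_forall_apply_eq fun A => hg.inducedEnd_injective ?_
    rw [← hP, hxy, hP]
  · refine eq_of_forall_apply_eq fun A => ?_
    obtain ⟨A, rfl⟩ := g.surjective A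
    rw [hP, hg.apply_vone]
  · rw [hP]
    refine eq_of_forall_apply_eq fun B => ?_
    obtain ⟨B, rfl⟩ := g.surjective B
    rw [hg.apply_inducedEnd (hP y), hP]

/-- The bilinear map with `v₁v₁ = -v₁ + s v₂`, `v₁v₂ = t v₂`, `v₂v₁ = m v₁ + r v₂` and
`v₂v₂ = q v₁ - m v₂`. -/
def normalForm (s t m r q : K) : WW K :=
  s • alphaM K 0 0 1 - alphaM K 0 0 0 + t • alphaM K 0 1 1 + m • alphaM K 1 0 0
    + r • alphaM K 1 0 1 + q • alphaM K 1 1 0 - m • alphaM K 1 1 1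

theorem w1_eq (c : K) : w1 K c = normalForm 1 (2 + 6 * c) 0 0 0 := by
  simp only [w1, normalForm, bE, Matrix.cons_val]
  module

theorem w2_eq (c d : K) : w2 K c d = normalForm 0 (1 + 3 * c + d) 0 (1 + 3 * c - d) 0 := by
  simp only [w2, normalForm, bE, Matrix.cons_val]
  module

theorem w3_eq (c d : K) : w3 K c d = normalForm 0 (-1) (-6) (3 - 6 * c) d := by
  simp only [w3, normalForm, bE, Matrix.cons_val]
  module

theorem w4_eq (c q : K) : w4 K c q = normalForm 0 (-1) 0 (3 - 6 * c) q := by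
  simp only [w4, normalForm, bE, Matrix.cons_val]
  module

theorem normalForm_apply (s t m r q : K) (x y : V2 K) :
    normalForm s t m r q x y =
      ![-(x 0 * y 0) + m * (x 1 * y 0) + q * (x 1 * y 1),
        s * (x 0 * y 0) + t * (x 0 * y 1) + r * (x 1 * y 0) - m * (x 1 * y 1)] := by
  ext i
  fin_cases i <;> simp [normalForm, alphaM]

/-- The equations between the parameters of two normal forms in the same orbit: here
`v₂ ↦ b v₁ + d v₂` is the linear automorphism realizing the orbit relation. -/
theorem IsAut.normalForm_relations {g : WW K ≃ₗ[K] WW K} (hg : IsAut K g)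
    {s t m r q s' t' m' r' q' : K}
    (h : g (normalForm s t m r q) = normalForm s' t' m' r' q') :
    ∃ b d : K, d ≠ 0 ∧ b * s = 0 ∧ s' = d * s ∧ b * (1 + t) = 0 ∧ b * s' + t' * d = d * t ∧
      m' * d - b = m + b * r ∧ b * s' + r' * d = d * r ∧
      -(b * b) + m' * (d * b) + q' * (d * d) = q - b * m ∧
      s' * (b * b) + t' * (b * d) + r' * (d * b) - m' * (d * d) = -(d * m) := by
  obtain ⟨P, hinj, hv, hP⟩ := hg.exists_linearMap
  let v2 : V2 K := ![0, 1]
  have hPx (x y : K) : P ![x, y] = ![x + P v2 0 * y, P v2 1 * y] := by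
    have hxy : ![x, y] = x • vone K + y • v2 := by
      ext i; fin_cases i <;> simp [vone, v2]
    rw [hxy, map_add, map_smul, map_smul, hv]
    ext i; fin_cases i <;> simp [vone, mul_comm]
  have key (x y x' y' : K) := hP (normalForm s t m r q) ![x, y] ![x', y']
  simp only [h, normalForm_apply, hPx] at key
  refine ⟨P v2 0, P v2 1, fun hd => ?_, ?_⟩
  · have h0 : ![-P v2 0, 1] = (0 : V2 K) := hinj <| by rw [hPx, hd, map_zero]; simp
    simpa using congr_fun h0 1
  · have h11 := key 1 0 1 0
    have h12 := key 1 0 0 1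
    have h21 := key 0 1 1 0
    have h22 := key 0 1 0 1
    simp [-mul_eq_zero, -zero_eq_mul] at h11 h12 h21 h22
    grind

end

/-- If g is an automorphism of W(2), w ∈ E and g(w) ∈ E, then g(w) = w;
consequently distinct elements of E lie in distinct orbits. -/
theorem statement17 (R : Set F) (hR0 : (0 : F) ∉ R)
    (hR : ∀ b : F, b ≠ 0 → ∃! q : F, q ∈ R ∧ ∃ s : F, b = q * s ^ 2) :
    (∀ w ∈ ESet F R, ∀ g : WW F ≃ₗ[F] WW F, IsAut F g → g w ∈ ESet F R → g w = w) ∧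
    (∀ w ∈ ESet F R, ∀ w' ∈ ESet F R, (∃ g : WW F ≃ₗ[F] WW F, IsAut F g ∧ g w = w') →
      w = w') := by
  have key : ∀ w ∈ ESet F R, ∀ g : WW F ≃ₗ[F] WW F, IsAut F g → g w ∈ ESet F R → g w = w := by
    intro w hw g hg hw'
    generalize hgw : g w = w' at hw'
    have mul_six {a b : F} (h : 6 * a = 6 * b) : a = b := mul_left_cancel₀ (by norm_num) h
    have h12 : (12 : F) ≠ 0 := by norm_num
    rcases hw with ⟨c, rfl⟩ | ⟨c, e, rfl⟩ | ⟨c, e, rfl⟩ | ⟨c, q, hq, rfl⟩ <;>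
      rcases hw' with ⟨c', rfl⟩ | ⟨c', e', rfl⟩ | ⟨c', e', rfl⟩ | ⟨c', q', hq', rfl⟩ <;>
      have hgw' := hgw <;>
      simp only [w1_eq, w2_eq, w3_eq, w4_eq] at hgw' <;>
      obtain ⟨b, d, hd, h1, h2, h3, h4, h5, h6, h7, h8⟩ := hg.normalForm_relations hgw'
    · obtain rfl : c = c' := mul_six (by grind)
      rfl
    · grind
    · grind
    · grind
    · grind
    · have hc : c = c' := mul_six (by grind)
      have he : e = e' := by grind
      rw [hc, he]
    · grind
    · grind
    · grind
    · grind
    · have hc : c = c' := mul_six (by grind)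
      have he : e = e' := by grind
      rw [hc, he]
    · grind
    · grind
    · grind
    · grind
    · have hc : c = c' := mul_six (by grind)
      have hq0 : q ≠ 0 := fun h0 => hR0 (h0 ▸ hq)
      have hqq : q = q' :=
        (hR q hq0).unique ⟨hq, 1, by ring⟩ ⟨hq', d, by grind⟩
      rw [hc, hqq]
  refine ⟨key, ?_⟩
  rintro w hw w' hw' ⟨g, hg, rfl⟩
  exact (key w hw g hg hw').symm

end
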